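/- arXiv:1904.03422 — 8 statements merged into one kernel-verified Lean document; each statement's English description precedes it below -/
import Mathlib

section
/- Let (X, d_X) and (Y, d_Y) be metric spaces, let γ : [0,1] → X be a rectifiable curve, and let f : X → Y be a continuous map such that d_f(x) ≤ M for every point x in the image of γ, where M > 0 is a constant. Then the image curve f ∘ γ : [0,1] → Y is rectifiable, and moreover L(f ∘ γ) ≤ 2 M L(γ). -/
open Filter Set Topology

/-- The upper pointwise dilation of a map `f` between metric spaces at a point `x`:
`d_f(x) = limsup_{y → x, y ≠ x} d(f x, f y) / d(x, y)`, taken in `[0,∞]`. -/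
noncomputable def upperDilation {X Y : Type*} [MetricSpace X] [MetricSpace Y]
    (f : X → Y) (x : X) : ENNReal :=
  Filter.limsup (fun y => edist (f x) (f y) / edist x y) (𝓝[≠] x)

/-- A curve whose increments are locally dominated at each point by those of `γ` has its endpoints
at distance controlled by the variation of `γ`. -/
lemma edist_le_mul_eVariationOn_of_eventually {X Y : Type*} [PseudoEMetricSpace X]
    [PseudoEMetricSpace Y] {γ : ℝ → X} {g : ℝ → Y} {C : ENNReal} {a b : ℝ} (hab : a ≤ b)
    (h : ∀ t ∈ Set.Icc a b, ∀ᶠ s in 𝓝[Set.Icc a b] t,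
      edist (g t) (g s) ≤ C * edist (γ t) (γ s)) :
    edist (g a) (g b) ≤ C * eVariationOn γ (Set.Icc a b) := by
  have step : ∀ s t, a ≤ s → s ≤ t → edist (g a) (g s) ≤ C * eVariationOn γ (Set.Icc a s) →
      edist (g s) (g t) ≤ C * edist (γ s) (γ t) →
      edist (g a) (g t) ≤ C * eVariationOn γ (Set.Icc a t) := by
    intro s t has hst h₁ h₂
    calc edist (g a) (g t) ≤ edist (g a) (g s) + edist (g s) (g t) := edist_triangle _ _ _
      _ ≤ C * eVariationOn γ (Set.Icc a s) + C * eVariationOn γ (Set.Icc s t) := by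
          gcongr
          refine h₂.trans ?_
          gcongr
          exact eVariationOn.edist_le γ (left_mem_Icc.2 hst) (right_mem_Icc.2 hst)
      _ = C * eVariationOn γ (Set.Icc a t) := by
          have := eVariationOn.Icc_add_Icc γ (s := Set.univ) has hst (mem_univ s)
          simp only [univ_inter] at this
          rw [← mul_add, this]
  set S : Set ℝ :=
    {t | t ∈ Set.Icc a b ∧ edist (g a) (g t) ≤ C * eVariationOn γ (Set.Icc a t)}
  have haS : a ∈ S := ⟨left_mem_Icc.2 hab, by simp⟩
  have hbdd : BddAbove S := ⟨b, fun t ht => ht.1.2⟩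
  set c := sSup S
  have hac : a ≤ c := le_csSup hbdd haS
  have hcb : c ≤ b := csSup_le ⟨a, haS⟩ fun t ht => ht.1.2
  obtain ⟨δ, hδ, hball⟩ := Metric.mem_nhdsWithin_iff.1 (h c ⟨hac, hcb⟩)
  obtain ⟨s, hsS, hs⟩ := exists_lt_of_lt_csSup ⟨a, haS⟩ (sub_lt_self c hδ)
  have hsc : s ≤ c := le_csSup hbdd hsS
  have hcS : edist (g a) (g c) ≤ C * eVariationOn γ (Set.Icc a c) := by
    refine step s c hsS.1.1 hsc hsS.2 ?_
    rw [edist_comm (g s), edist_comm (γ s)]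
    refine hball ⟨?_, hsS.1⟩
    rw [Metric.mem_ball, Real.dist_eq, abs_lt]
    constructor <;> linarith
  rcases hcb.eq_or_lt with hcb' | hcb'
  · rwa [hcb'] at hcS
  exfalso
  have hct : c < min b (c + δ / 2) := lt_min hcb' (by linarith)
  have htb : min b (c + δ / 2) ∈ Set.Icc a b := ⟨hac.trans hct.le, min_le_left _ _⟩
  refine hct.not_ge (le_csSup hbdd ⟨htb, step c _ hac hct.le hcS (hball ⟨?_, htb⟩)⟩)
  have := min_le_right b (c + δ / 2)
  rw [Metric.mem_ball, Real.dist_eq, abs_lt]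
  constructor <;> linarith

/-- If the increments of `g` are locally dominated at each point by `C` times those of `γ`, then
the variation of `g` is at most `C` times that of `γ`. -/
lemma eVariationOn_le_mul_of_eventually {X Y : Type*} [PseudoEMetricSpace X]
    [PseudoEMetricSpace Y] {γ : ℝ → X} {g : ℝ → Y} {C : ENNReal} {a b : ℝ}
    (h : ∀ t ∈ Set.Icc a b, ∀ᶠ s in 𝓝[Set.Icc a b] t,
      edist (g t) (g s) ≤ C * edist (γ t) (γ s)) :
    eVariationOn g (Set.Icc a b) ≤ C * eVariationOn γ (Set.Icc a b) := by
  refine iSup_le ?_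
  rintro ⟨n, u, hu, hus⟩
  have hsub : ∀ i j, Set.Icc (u i) (u j) ⊆ Set.Icc a b := fun i j =>
    Icc_subset_Icc (hus i).1 (hus j).2
  calc ∑ i ∈ Finset.range n, edist (g (u (i + 1))) (g (u i))
      ≤ ∑ i ∈ Finset.range n, C * eVariationOn γ (Set.Icc (u i) (u (i + 1))) := by
        refine Finset.sum_le_sum fun i _ => ?_
        rw [edist_comm]
        exact edist_le_mul_eVariationOn_of_eventually (hu i.le_succ) fun t ht =>
          (h t (hsub _ _ ht)).filter_mono (nhdsWithin_mono _ (hsub _ _))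
    _ = C * eVariationOn γ (Set.Icc (u 0) (u n)) := by
        rw [← Finset.mul_sum, eVariationOn.sum' γ hu]
    _ ≤ C * eVariationOn γ (Set.Icc a b) := by
        gcongr
        exact eVariationOn.mono γ (hsub _ _)

lemma eventually_edist_le_mul_of_upperDilation_lt {X Y : Type*} [MetricSpace X] [MetricSpace Y]
    {f : X → Y} {x : X} {C : ENNReal} (h : upperDilation f x < C) :
    ∀ᶠ y in 𝓝 x, edist (f x) (f y) ≤ C * edist x y := by
  have h' := eventually_nhdsWithin_iff.1 (eventually_lt_of_limsup_lt h)
  filter_upwards [h'] with y hy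
  rcases eq_or_ne y x with rfl | hne
  · simp
  · exact (ENNReal.div_le_iff (edist_pos.2 hne.symm).ne' (edist_ne_top x y)).1 (hy hne).le

theorem stmt0 {X Y : Type*} [MetricSpace X] [MetricSpace Y]
    (γ : ℝ → X) (hγ : ContinuousOn γ (Set.Icc 0 1))
    (hrect : eVariationOn γ (Set.Icc 0 1) ≠ ⊤)
    (f : X → Y) (hf : Continuous f)
    (M : ℝ) (hM : 0 < M)
    (hdil : ∀ x ∈ γ '' Set.Icc 0 1, upperDilation f x ≤ ENNReal.ofReal M) :
    eVariationOn (f ∘ γ) (Set.Icc 0 1) ≠ ⊤ ∧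
      eVariationOn (f ∘ γ) (Set.Icc 0 1) ≤
        ENNReal.ofReal (2 * M) * eVariationOn γ (Set.Icc 0 1) := by
  have hlt : ENNReal.ofReal M < ENNReal.ofReal (2 * M) :=
    (ENNReal.ofReal_lt_ofReal_iff (by linarith)).2 (by linarith)
  have key : eVariationOn (f ∘ γ) (Set.Icc 0 1) ≤
      ENNReal.ofReal (2 * M) * eVariationOn γ (Set.Icc 0 1) :=
    eVariationOn_le_mul_of_eventually fun t ht =>
      (hγ t ht).eventually (eventually_edist_le_mul_of_upperDilation_lt
        ((hdil _ (mem_image_of_mem γ ht)).trans_lt hlt))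
  exact ⟨ne_top_of_le_ne_top (ENNReal.mul_ne_top ENNReal.ofReal_ne_top hrect) key, key⟩
end

section
/- Let X and Y be real normed vector spaces, let B_X = {x ∈ X : ‖x‖ < 1} be the open unit ball of X, and let f : B_X → Y be Fréchet differentiable at every point of B_X. Then sup_{x ∈ B_X} (1 − ‖x‖²) ‖Df(x)‖ = sup_{x, y ∈ B_X, x ≠ y} √(1 − ‖x‖²) · √(1 − ‖y‖²) · ‖f(x) − f(y)‖ / ‖x − y‖, where both suprema are taken in [0, ∞]. -/
open Filter Topology

/-- If `(1 - ‖z‖ ^ 2) * ‖Df z‖ ≤ M` on the open unit ball, then integrating along segments bounds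
the weighted difference quotients of `f` by `M`. -/
lemma norm_sub_le_of_weighted_fderiv_le {X Y : Type*} [NormedAddCommGroup X] [NormedSpace ℝ X]
    [NormedAddCommGroup Y] [NormedSpace ℝ Y] {f : X → Y} {f' : X → X →L[ℝ] Y}
    (hf : ∀ x : X, ‖x‖ < 1 → HasFDerivAt f (f' x) x) {M : ℝ} (hM : 0 ≤ M)
    (h : ∀ x : X, ‖x‖ < 1 → (1 - ‖x‖ ^ 2) * ‖f' x‖ ≤ M) {x y : X} (hx : ‖x‖ < 1) (hy : ‖y‖ < 1) :
    ‖f y - f x‖ ≤ M * ‖y - x‖ / (√(1 - ‖x‖ ^ 2) * √(1 - ‖y‖ ^ 2)) := by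
  set a := ‖x‖
  set b := ‖y‖
  have ha0 : 0 ≤ a := norm_nonneg x
  have hb0 : 0 ≤ b := norm_nonneg y
  let γ : ℝ → X := fun t => x + t • (y - x)
  let r : ℝ → ℝ := fun t => a + t * (b - a)
  have hr0 : ∀ t ∈ Set.Icc (0 : ℝ) 1, 0 ≤ r t := fun t ht => by
    simp only [r]; nlinarith [ht.1, ht.2, mul_nonneg ht.1 hb0, mul_nonneg (sub_nonneg.2 ht.2) ha0]
  have hr1 : ∀ t ∈ Set.Icc (0 : ℝ) 1, r t < 1 := fun t ht => by
    simp only [r]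
    rcases ht.1.eq_or_lt with h0 | h0
    · simpa [← h0] using hx
    · nlinarith [mul_pos h0 (sub_pos.2 hy), mul_nonneg (sub_nonneg.2 ht.2) (sub_pos.2 hx).le]
  have hγr : ∀ t ∈ Set.Icc (0 : ℝ) 1, ‖γ t‖ ≤ r t := fun t ht => by
    have e : γ t = (1 - t) • x + t • y := by simp only [γ]; module
    calc ‖γ t‖ ≤ ‖(1 - t) • x‖ + ‖t • y‖ := e ▸ norm_add_le _ _
      _ = r t := by
        rw [norm_smul, norm_smul, Real.norm_of_nonneg ht.1,
          Real.norm_of_nonneg (sub_nonneg.2 ht.2)]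
        simp only [r]; ring
  have hpos : ∀ t ∈ Set.Icc (0 : ℝ) 1, 0 < 1 - r t ^ 2 := fun t ht => by
    nlinarith [hr0 t ht, hr1 t ht]
  have hapos : 0 < 1 - a ^ 2 := by nlinarith
  have hg : ∀ t ∈ Set.Icc (0 : ℝ) 1,
      HasDerivAt (fun t => f (γ t) - f x) (f' (γ t) (y - x)) t := fun t ht => by
    have hγ : HasDerivAt γ (y - x) t := by
      simpa [γ] using ((hasDerivAt_id t).smul_const (y - x)).const_add x
    exact ((hf _ ((hγr t ht).trans_lt (hr1 t ht))).comp_hasDerivAt t hγ).sub_const _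
  let B : ℝ → ℝ := fun t => M * ‖y - x‖ / √(1 - a ^ 2) * (t / √(1 - r t ^ 2))
  let B' : ℝ → ℝ := fun t =>
    M * ‖y - x‖ / √(1 - a ^ 2) * ((1 - r t * a) / ((1 - r t ^ 2) * √(1 - r t ^ 2)))
  have hB : ∀ t ∈ Set.Icc (0 : ℝ) 1, HasDerivAt B (B' t) t := fun t ht => by
    have hr : HasDerivAt r (b - a) t := by
      simpa [r] using ((hasDerivAt_id t).mul_const (b - a)).const_add a
    have hs := ((hr.pow 2).const_sub 1).sqrt (hpos t ht).ne'
    have hs0 := Real.sqrt_pos.2 (hpos t ht)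
    refine (((hasDerivAt_id t).div hs hs0.ne').const_mul _).congr_deriv ?_
    simp only [B', id]
    congr 1
    have hsq := Real.sq_sqrt (hpos t ht).le
    simp only [Pi.pow_apply]
    rw [hsq]
    have hp := (hpos t ht).ne'
    field_simp
    rw [hsq]
    simp only [r]
    ring
  have key := image_norm_le_of_norm_deriv_right_le_deriv_boundary' (a := (0 : ℝ)) (b := 1)
    (f := fun t => f (γ t) - f x) (f' := fun t => f' (γ t) (y - x)) (B := B) (B' := B')
    (fun t ht => (hg t ht).continuousAt.continuousWithinAt)
    (fun t ht => (hg t (Set.Ico_subset_Icc_self ht)).hasDerivWithinAt)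
    (by simp [γ, B])
    (fun t ht => (hB t ht).continuousAt.continuousWithinAt)
    (fun t ht => (hB t (Set.Ico_subset_Icc_self ht)).hasDerivWithinAt)
    (fun t ht' => by
      have ht := Set.Ico_subset_Icc_self ht'
      have hp := hpos t ht
      have hγ1 := (hγr t ht).trans_lt (hr1 t ht)
      have hle : 1 - r t ^ 2 ≤ 1 - ‖γ t‖ ^ 2 := by
        have := pow_le_pow_left₀ (norm_nonneg _) (hγr t ht) 2
        linarith
      have h1 : ‖f' (γ t)‖ ≤ M / (1 - r t ^ 2) := by
        rw [le_div_iff₀ hp, mul_comm]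
        exact (mul_le_mul_of_nonneg_right hle (norm_nonneg _)).trans (h _ hγ1)
      have h2 : √(1 - a ^ 2) * √(1 - r t ^ 2) ≤ 1 - r t * a := by
        rw [← Real.sqrt_mul hapos.le]
        refine Real.sqrt_le_iff.2 ⟨?_, ?_⟩
        · nlinarith [hr0 t ht, hr1 t ht]
        · nlinarith [sq_nonneg (r t - a)]
      have hs := Real.sqrt_pos.2 hp
      have hsa := Real.sqrt_pos.2 hapos
      calc ‖f' (γ t) (y - x)‖ ≤ ‖f' (γ t)‖ * ‖y - x‖ := (f' (γ t)).le_opNorm _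
        _ ≤ M / (1 - r t ^ 2) * ‖y - x‖ := by gcongr
        _ = M * ‖y - x‖ / (1 - r t ^ 2) * 1 := by ring
        _ ≤ M * ‖y - x‖ / (1 - r t ^ 2) *
            ((1 - r t * a) / (√(1 - a ^ 2) * √(1 - r t ^ 2))) := by
          gcongr
          rwa [one_le_div (by positivity)]
        _ = B' t := by simp only [B']; field_simp)
    (Set.right_mem_Icc.2 zero_le_one)
  have e1 : γ 1 = y := by simp [γ]
  have e2 : r 1 = b := by simp [r]
  simp only [B, e1, e2] at key
  refine key.trans_eq ?_
  rw [div_mul_div_comm, mul_one]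

/-- If the weighted difference quotients of `f` at `x` are bounded by `M`, then so is
`(1 - ‖x‖ ^ 2) * ‖Df x‖`. -/
lemma weighted_fderiv_le_of_norm_sub_le {X Y : Type*} [NormedAddCommGroup X] [NormedSpace ℝ X]
    [NormedAddCommGroup Y] [NormedSpace ℝ Y] {f : X → Y} {x : X} {L : X →L[ℝ] Y}
    (hf : HasFDerivAt f L x) {M : ℝ} (hM : 0 ≤ M) (hx : ‖x‖ < 1)
    (h : ∀ y : X, ‖y‖ < 1 → x ≠ y →
      √(1 - ‖x‖ ^ 2) * √(1 - ‖y‖ ^ 2) * ‖f x - f y‖ / ‖x - y‖ ≤ M) :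
    (1 - ‖x‖ ^ 2) * ‖L‖ ≤ M := by
  have hxpos : 0 < 1 - ‖x‖ ^ 2 := by nlinarith [norm_nonneg x]
  rw [mul_comm, ← le_div_iff₀ hxpos]
  refine le_of_forall_gt_imp_ge_of_dense fun K hK => ?_
  have hlim : Tendsto (fun y : X => M / (√(1 - ‖x‖ ^ 2) * √(1 - ‖y‖ ^ 2))) (𝓝 x)
      (𝓝 (M / (1 - ‖x‖ ^ 2))) := by
    have hc : ContinuousAt (fun y : X => M / (√(1 - ‖x‖ ^ 2) * √(1 - ‖y‖ ^ 2))) x := by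
      refine ContinuousAt.div (by fun_prop) (by fun_prop) ?_
      rw [Real.mul_self_sqrt hxpos.le]
      exact hxpos.ne'
    have := hc.tendsto
    rwa [Real.mul_self_sqrt hxpos.le] at this
  have hK0 : 0 ≤ K := (div_nonneg hM hxpos.le).trans hK.le
  refine hf.le_of_lip' hK0 ?_
  filter_upwards [hlim.eventually_lt_const hK,
    continuous_norm.continuousAt.eventually_lt_const hx] with y hyK hy
  rcases eq_or_ne x y with rfl | hne
  · simp
  have hypos : 0 < 1 - ‖y‖ ^ 2 := by nlinarith [norm_nonneg y]
  have hs := mul_pos (Real.sqrt_pos.2 hxpos) (Real.sqrt_pos.2 hypos)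
  have h1 := h y hy hne
  rw [div_le_iff₀ (norm_pos_iff.2 (sub_ne_zero.2 hne))] at h1
  rw [div_lt_iff₀ hs] at hyK
  rw [norm_sub_rev (f y), norm_sub_rev y]
  refine le_of_mul_le_mul_left ?_ hs
  calc _ ≤ M * ‖x - y‖ := h1
    _ ≤ K * (√(1 - ‖x‖ ^ 2) * √(1 - ‖y‖ ^ 2)) * ‖x - y‖ := by gcongr
    _ = _ := by ring

theorem stmt4 {X Y : Type*} [NormedAddCommGroup X] [NormedSpace ℝ X]
    [NormedAddCommGroup Y] [NormedSpace ℝ Y]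
    (f : X → Y) (f' : X → X →L[ℝ] Y)
    (hf : ∀ x : X, ‖x‖ < 1 → HasFDerivAt f (f' x) x) :
    (⨆ (x : X) (_ : ‖x‖ < 1), ENNReal.ofReal ((1 - ‖x‖ ^ 2) * ‖f' x‖)) =
      ⨆ (x : X) (_ : ‖x‖ < 1) (y : X) (_ : ‖y‖ < 1) (_ : x ≠ y),
        ENNReal.ofReal (Real.sqrt (1 - ‖x‖ ^ 2) * Real.sqrt (1 - ‖y‖ ^ 2) *
          ‖f x - f y‖ / ‖x - y‖) := by
  refine eq_of_forall_ge_iff fun S => ?_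
  simp only [iSup_le_iff]
  rcases eq_or_ne S ⊤ with rfl | hS
  · simp
  simp only [ENNReal.ofReal_le_iff_le_toReal hS]
  have hM : 0 ≤ S.toReal := ENNReal.toReal_nonneg
  refine ⟨fun h x hx y hy hne => ?_, fun h x hx =>
    weighted_fderiv_le_of_norm_sub_le (hf x hx) hM hx (h x hx)⟩
  have key := norm_sub_le_of_weighted_fderiv_le hf hM h hy hx
  have hxpos : 0 < 1 - ‖x‖ ^ 2 := by nlinarith [norm_nonneg x]
  have hypos : 0 < 1 - ‖y‖ ^ 2 := by nlinarith [norm_nonneg y]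
  rw [le_div_iff₀ (mul_pos (Real.sqrt_pos.2 hypos) (Real.sqrt_pos.2 hxpos))] at key
  rw [div_le_iff₀ (norm_pos_iff.2 (sub_ne_zero.2 hne))]
  linarith
end

section
/- Let X and Y be real normed vector spaces, let B_X = {x ∈ X : ‖x‖ < 1} be the open unit ball of X, let f : B_X → Y be Fréchet differentiable at every point of B_X, and let M ≥ 0 be a constant such that (1 − ‖x‖²) ‖Df(x)‖ ≤ M for every x ∈ B_X. Then √(1 − ‖x‖²) · √(1 − ‖y‖²) · ‖f(x) − f(y)‖ ≤ M ‖x − y‖ for all x, y ∈ B_X. -/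
/-- The bound behind the segment estimate: the hyperbolic sine of the Poincaré distance
from `a` to `c = a + t * (b - a)`, divided by `b - a`, grows at rate at least `1 / (1 - c ^ 2)`. -/
lemma exists_hasDerivAt_div_sqrt_mul_sqrt {a b t : ℝ} (ha : |a| < 1)
    (hc : |a + t * (b - a)| < 1) :
    ∃ d, HasDerivAt
        (fun s : ℝ ↦ s / (√(1 - (a + s * (b - a)) ^ 2) * √(1 - a ^ 2))) d t ∧
      1 / (1 - (a + t * (b - a)) ^ 2) ≤ d := by
  set c := a + t * (b - a) with hcdef
  have ha' : 0 < 1 - a ^ 2 := by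
    have := (sq_lt_one_iff_abs_lt_one a).2 ha
    linarith
  have hc' : 0 < 1 - c ^ 2 := by
    have := (sq_lt_one_iff_abs_lt_one c).2 hc
    linarith
  have hp : 0 < √(1 - c ^ 2) := Real.sqrt_pos.2 hc'
  have hq : 0 < √(1 - a ^ 2) := Real.sqrt_pos.2 ha'
  have hp2 : √(1 - c ^ 2) ^ 2 = 1 - c ^ 2 := Real.sq_sqrt hc'.le
  have hq2 : √(1 - a ^ 2) ^ 2 = 1 - a ^ 2 := Real.sq_sqrt ha'.le
  have h1 : HasDerivAt (fun s : ℝ ↦ a + s * (b - a)) (b - a) t := by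
    simpa using ((hasDerivAt_id t).mul_const (b - a)).const_add a
  have h2 := (((h1.pow 2).const_sub 1).sqrt hc'.ne').mul_const √(1 - a ^ 2)
  refine ⟨_, (hasDerivAt_id t).div h2 (mul_pos hp hq).ne', ?_⟩
  simp only [Pi.pow_apply, ← hcdef, id]
  set p := √(1 - c ^ 2)
  set q := √(1 - a ^ 2)
  have key : p * q ≤ 1 - a * c := by nlinarith [sq_nonneg (p - q), sq_nonneg (a - c)]
  have htc : t * (b - a) = c - a := by rw [hcdef]; ring
  rw [← hp2]
  have hd : (1 * (p * q) - t * (-(((2 : ℕ) : ℝ) * c ^ (2 - 1) * (b - a)) / (2 * p) * q)) /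
      (p * q) ^ 2 = (1 - a * c) / (p ^ 3 * q) := by
    have hnum : p ^ 2 + c * (t * (b - a)) = 1 - a * c := by rw [htc, hp2]; ring
    rw [← hnum]
    field_simp
    norm_num
    ring
  rw [hd, div_le_div_iff₀ (by positivity) (by positivity)]
  calc 1 * (p ^ 3 * q) = (p * q) * p ^ 2 := by ring
    _ ≤ (1 - a * c) * p ^ 2 := by gcongr

theorem stmt5 {X Y : Type*} [NormedAddCommGroup X] [NormedSpace ℝ X]
    [NormedAddCommGroup Y] [NormedSpace ℝ Y]
    (f : X → Y) (f' : X → X →L[ℝ] Y)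
    (hf : ∀ x : X, ‖x‖ < 1 → HasFDerivAt f (f' x) x)
    (M : ℝ) (hM : 0 ≤ M)
    (hbd : ∀ x : X, ‖x‖ < 1 → (1 - ‖x‖ ^ 2) * ‖f' x‖ ≤ M) :
    ∀ x y : X, ‖x‖ < 1 → ‖y‖ < 1 →
      Real.sqrt (1 - ‖x‖ ^ 2) * Real.sqrt (1 - ‖y‖ ^ 2) * ‖f x - f y‖ ≤ M * ‖x - y‖ := by
  intro x y hx hy
  have hseg : ∀ t ∈ Set.Icc (0 : ℝ) 1,
      ‖x + t • (y - x)‖ ≤ ‖x‖ + t * (‖y‖ - ‖x‖) := fun t ht ↦ by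
    calc ‖x + t • (y - x)‖ = ‖(1 - t) • x + t • y‖ := by congr 1; module
      _ ≤ ‖(1 - t) • x‖ + ‖t • y‖ := norm_add_le _ _
      _ = ‖x‖ + t * (‖y‖ - ‖x‖) := by
        rw [norm_smul_of_nonneg (sub_nonneg.2 ht.2), norm_smul_of_nonneg ht.1]; ring
  have hc : ∀ t ∈ Set.Icc (0 : ℝ) 1, ‖x‖ + t * (‖y‖ - ‖x‖) < 1 := fun t ht ↦ by
    rcases ht.2.eq_or_lt with rfl | h
    · linarith
    · nlinarith [mul_pos (sub_pos.2 h) (sub_pos.2 hx), mul_nonneg ht.1 (sub_pos.2 hy).le]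
  have hγ : ∀ t ∈ Set.Icc (0 : ℝ) 1, HasDerivAt (fun s : ℝ ↦ f (x + s • (y - x)) - f x)
      (f' (x + t • (y - x)) (y - x)) t := fun t ht ↦ by
    have h1 : HasDerivAt (fun s : ℝ ↦ x + s • (y - x)) (y - x) t := by
      simpa using ((hasDerivAt_id t).smul_const (y - x)).const_add x
    exact ((hf _ ((hseg t ht).trans_lt (hc t ht))).comp_hasDerivAt t h1).sub_const _
  have hB : ∀ t : ℝ, ∃ d, t ∈ Set.Icc (0 : ℝ) 1 → HasDerivAt
        (fun s : ℝ ↦ s / (√(1 - (‖x‖ + s * (‖y‖ - ‖x‖)) ^ 2) * √(1 - ‖x‖ ^ 2))) d t ∧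
      1 / (1 - (‖x‖ + t * (‖y‖ - ‖x‖)) ^ 2) ≤ d := fun t ↦ by
    by_cases ht : t ∈ Set.Icc (0 : ℝ) 1
    · obtain ⟨d, hd⟩ := exists_hasDerivAt_div_sqrt_mul_sqrt (a := ‖x‖) (b := ‖y‖) (t := t)
        (by rwa [abs_norm])
        (by rw [abs_of_nonneg ((norm_nonneg _).trans (hseg t ht))]; exact hc t ht)
      exact ⟨d, fun _ ↦ hd⟩
    · exact ⟨0, fun h ↦ absurd h ht⟩
  choose d hd using hB
  have hmain := image_norm_le_of_norm_deriv_right_le_deriv_boundary'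
    (fun t ht ↦ (hγ t ht).continuousAt.continuousWithinAt)
    (fun t ht ↦ (hγ t (Set.Ico_subset_Icc_self ht)).hasDerivWithinAt)
    (by simp)
    (fun t ht ↦ ((hd t ht).1.const_mul (M * ‖y - x‖)).continuousAt.continuousWithinAt)
    (fun t ht ↦ ((hd t (Set.Ico_subset_Icc_self ht)).1.const_mul
      (M * ‖y - x‖)).hasDerivWithinAt)
    (fun t ht ↦ by
      replace ht := Set.Ico_subset_Icc_self ht
      have hs := hseg t ht
      have hlt := hc t ht
      have hnn := norm_nonneg (x + t • (y - x))
      have hpos : 0 < 1 - (‖x‖ + t * (‖y‖ - ‖x‖)) ^ 2 := by nlinarith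
      have hle : 1 - (‖x‖ + t * (‖y‖ - ‖x‖)) ^ 2 ≤ 1 - ‖x + t • (y - x)‖ ^ 2 := by gcongr
      calc ‖f' (x + t • (y - x)) (y - x)‖ ≤ ‖f' (x + t • (y - x))‖ * ‖y - x‖ :=
            ContinuousLinearMap.le_opNorm _ _
        _ ≤ M / (1 - (‖x‖ + t * (‖y‖ - ‖x‖)) ^ 2) * ‖y - x‖ := by
            gcongr
            rw [le_div_iff₀' hpos]
            exact (mul_le_mul_of_nonneg_right hle (norm_nonneg _)).trans
              (hbd _ (hs.trans_lt hlt))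
        _ = M * ‖y - x‖ * (1 / (1 - (‖x‖ + t * (‖y‖ - ‖x‖)) ^ 2)) := by ring
        _ ≤ M * ‖y - x‖ * d t := by gcongr; exact (hd t ht).2)
    (Set.right_mem_Icc.2 zero_le_one)
  have hp : 0 < √(1 - ‖x‖ ^ 2) := Real.sqrt_pos.2 (by nlinarith [norm_nonneg x])
  have hq : 0 < √(1 - ‖y‖ ^ 2) := Real.sqrt_pos.2 (by nlinarith [norm_nonneg y])
  simp only [one_smul, one_mul, add_sub_cancel, mul_one_div] at hmain
  rw [le_div_iff₀' (mul_pos hq hp)] at hmain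
  rwa [norm_sub_rev (f x), norm_sub_rev x, mul_comm √(1 - ‖x‖ ^ 2)]
end

section
/- Let X and Y be real normed vector spaces, let B_X = {x ∈ X : ‖x‖ < 1} be the open unit ball of X, let f : B_X → Y be Fréchet differentiable at every point of B_X, and let M ≥ 0 be a constant such that √(1 − ‖x‖²) · √(1 − ‖y‖²) · ‖f(x) − f(y)‖ ≤ M ‖x − y‖ for all x, y ∈ B_X. Then (1 − ‖x‖²) ‖Df(x)‖ ≤ M for every x ∈ B_X. -/
theorem stmt6 {X Y : Type*} [NormedAddCommGroup X] [NormedSpace ℝ X]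
    [NormedAddCommGroup Y] [NormedSpace ℝ Y]
    (f : X → Y) (f' : X → X →L[ℝ] Y)
    (hf : ∀ x : X, ‖x‖ < 1 → HasFDerivAt f (f' x) x)
    (M : ℝ) (hM : 0 ≤ M)
    (hbd : ∀ x y : X, ‖x‖ < 1 → ‖y‖ < 1 →
      Real.sqrt (1 - ‖x‖ ^ 2) * Real.sqrt (1 - ‖y‖ ^ 2) * ‖f x - f y‖ ≤ M * ‖x - y‖) :
    ∀ x : X, ‖x‖ < 1 → (1 - ‖x‖ ^ 2) * ‖f' x‖ ≤ M := by
  intro x hx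
  by_contra! h
  have ha : 0 ≤ 1 - ‖x‖ ^ 2 := by nlinarith [norm_nonneg x]
  have hpos : 0 < ‖f' x‖ := pos_of_mul_pos_right (hM.trans_lt h) ha
  obtain ⟨c, hMc, hca⟩ := exists_between ((div_lt_iff₀ hpos).2 h)
  have hc : 0 < c := (div_nonneg hM hpos.le).trans_lt hMc
  have hcont : Continuous fun y : X => √(1 - ‖y‖ ^ 2) * √(1 - ‖x‖ ^ 2) := by fun_prop
  have hweight : ∀ᶠ y in nhds x, c < √(1 - ‖y‖ ^ 2) * √(1 - ‖x‖ ^ 2) :=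
    hcont.continuousAt.eventually_const_lt (hca.trans_eq (Real.mul_self_sqrt ha).symm)
  have hball : ∀ᶠ y in nhds x, ‖y‖ < 1 := continuous_norm.continuousAt.eventually_lt_const hx
  have hle : ‖f' x‖ ≤ M / c := by
    refine (hf x hx).le_of_lip' (div_nonneg hM hc.le) ?_
    filter_upwards [hweight, hball] with y hy hy1
    rw [div_mul_eq_mul_div, le_div_iff₀' hc]
    exact (mul_le_mul_of_nonneg_right hy.le (norm_nonneg _)).trans (hbd y x hy1 hx)
  rw [le_div_iff₀' hc] at hle
  exact hle.not_gt ((div_lt_iff₀ hpos).1 hMc)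
end

section
/- Let B = {x ∈ ℝ^m : ‖x‖ < 1} be the open unit ball of Euclidean space ℝ^m, let f : B → ℝ² be Fréchet differentiable at every point of B, and let M ≥ 0 be a constant. Then ‖Df(x)‖ / (1 + ‖f(x)‖²) ≤ M / (1 − ‖x‖²) holds for every x ∈ B if and only if ‖f(x) − f(y)‖ ≤ M ‖x − y‖ · (√(1 + ‖f(x)‖²) · √(1 + ‖f(y)‖²)) / (√(1 − ‖x‖²) · √(1 − ‖y‖²)) holds for all x, y ∈ B. -/
open EuclideanGeometry in
/-- The derivative of an inversion is conformal. -/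
theorem exists_hasFDerivAt_inversion {F : Type*} [NormedAddCommGroup F] [InnerProductSpace ℝ F]
    {c x : F} (R : ℝ) (hx : x ≠ c) :
    ∃ A : F →L[ℝ] F, HasFDerivAt (inversion c R) A x ∧
      ∀ v, ‖A v‖ = (R / dist x c) ^ 2 * ‖v‖ := by
  refine ⟨_, hasFDerivAt_inversion hx, fun v => ?_⟩
  simp [norm_smul, div_pow]

/-- `g` is differentiable on the unit ball and its derivative there has norm at most `M` with
respect to the hyperbolic metric `‖dx‖ / (1 - ‖x‖ ^ 2)`. -/
def HyperbolicDerivBound {E G : Type*} [NormedAddCommGroup E] [NormedSpace ℝ E]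
    [NormedAddCommGroup G] [NormedSpace ℝ G] (g : E → G) (M : ℝ) : Prop :=
  ∀ x, ‖x‖ < 1 → ∃ A : E →L[ℝ] G, HasFDerivAt g A x ∧
    ∀ v, ‖A v‖ * (1 - ‖x‖ ^ 2) ≤ M * ‖v‖

theorem one_sub_norm_sq_pos {E : Type*} [NormedAddCommGroup E] {x : E} (hx : ‖x‖ < 1) :
    0 < 1 - ‖x‖ ^ 2 := by
  nlinarith [norm_nonneg x]

theorem HyperbolicDerivBound.norm_sub_zero_le {E G : Type*} [NormedAddCommGroup E]
    [NormedSpace ℝ E] [NormedAddCommGroup G] [NormedSpace ℝ G] {g : E → G} {M : ℝ}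
    (hM : 0 ≤ M) (hg : HyperbolicDerivBound g M) {v : E} (hv : ‖v‖ < 1) :
    ‖g v - g 0‖ ≤ M * ‖v‖ / √(1 - ‖v‖ ^ 2) := by
  have hmem : ∀ s ∈ Set.Icc (0 : ℝ) 1, ‖s • v‖ < 1 := fun s hs => by
    rw [norm_smul, Real.norm_of_nonneg hs.1]
    nlinarith [norm_nonneg v, hs.1, hs.2]
  have hpos : ∀ s ∈ Set.Icc (0 : ℝ) 1, 0 < 1 - (s * ‖v‖) ^ 2 := fun s hs => by
    have := one_sub_norm_sq_pos (hmem s hs)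
    rwa [norm_smul, Real.norm_of_nonneg hs.1] at this
  choose! A hA hAb using hg
  have hd : ∀ s ∈ Set.Icc (0 : ℝ) 1,
      HasDerivAt (fun t : ℝ => g (t • v) - g 0) (A (s • v) v) s := fun s hs => by
    have h1 : HasDerivAt (fun t : ℝ => t • v) v s := by
      simpa using (hasDerivAt_id s).smul_const v
    exact ((hA _ (hmem s hs)).comp_hasDerivAt s h1).sub_const _
  have hB : ∀ s ∈ Set.Icc (0 : ℝ) 1,
      HasDerivAt (fun t : ℝ => M * (t * ‖v‖) / √(1 - (t * ‖v‖) ^ 2))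
        (M * ‖v‖ / √(1 - (s * ‖v‖) ^ 2) ^ 3) s := fun s hs => by
    have hp := hpos s hs
    have hsq := Real.sq_sqrt hp.le
    have hw := Real.sqrt_pos.2 hp
    have h0 : HasDerivAt (fun t : ℝ => t * ‖v‖) ‖v‖ s := by
      simpa using (hasDerivAt_id s).mul_const ‖v‖
    refine ((h0.const_mul M).div (((h0.pow 2).const_sub 1).sqrt hp.ne') hw.ne').congr_deriv ?_
    simp only [Pi.pow_apply]
    set w := √(1 - (s * ‖v‖) ^ 2)
    field_simp
    push_cast
    linear_combination (2 * M * ‖v‖) * hsq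
  have key := image_norm_le_of_norm_deriv_right_le_deriv_boundary'
    (f := fun t : ℝ => g (t • v) - g 0) (a := 0) (b := 1)
    (fun s hs => (hd s hs).continuousAt.continuousWithinAt)
    (fun s hs => (hd s (Set.Ico_subset_Icc_self hs)).hasDerivWithinAt)
    (B := fun t : ℝ => M * (t * ‖v‖) / √(1 - (t * ‖v‖) ^ 2)) (by simp)
    (fun s hs => (hB s hs).continuousAt.continuousWithinAt)
    (fun s hs => (hB s (Set.Ico_subset_Icc_self hs)).hasDerivWithinAt)
    (fun s hs => by
      have hs' := Set.Ico_subset_Icc_self hs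
      have hp := hpos s hs'
      have hsq := Real.sq_sqrt hp.le
      have hw := Real.sqrt_pos.2 hp
      have hb := hAb _ (hmem s hs') v
      rw [norm_smul, Real.norm_of_nonneg hs.1] at hb
      rw [le_div_iff₀ (by positivity)]
      have hw1 : √(1 - (s * ‖v‖) ^ 2) ≤ 1 :=
        Real.sqrt_le_one.2 (by nlinarith [sq_nonneg (s * ‖v‖)])
      calc ‖A (s • v) v‖ * √(1 - (s * ‖v‖) ^ 2) ^ 3
          = (‖A (s • v) v‖ * (1 - (s * ‖v‖) ^ 2)) * √(1 - (s * ‖v‖) ^ 2) := by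
            rw [pow_succ, hsq]; ring
        _ ≤ (M * ‖v‖) * 1 := by gcongr
        _ = M * ‖v‖ := mul_one _)
    (Set.right_mem_Icc.2 zero_le_one)
  simpa using key

open EuclideanGeometry in
/-- An inversion in a sphere orthogonal to the unit sphere. -/
theorem one_sub_norm_sq_inversion {E : Type*} [NormedAddCommGroup E] [InnerProductSpace ℝ E]
    {q x : E} {R : ℝ} (hq : ‖q‖ ^ 2 = R ^ 2 + 1) (hx : x ≠ q) :
    1 - ‖inversion q R x‖ ^ 2 = (R / dist x q) ^ 2 * (1 - ‖x‖ ^ 2) := by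
  have hd : 0 < dist x q := dist_pos.2 hx
  have h1 : ‖inversion q R x‖ ^ 2 = ((R / dist x q) ^ 2) ^ 2 * dist x q ^ 2
      + 2 * ((R / dist x q) ^ 2 * inner ℝ (x - q) q) + ‖q‖ ^ 2 := by
    rw [inversion, vadd_eq_add, vsub_eq_sub, norm_add_sq_real, norm_smul, real_inner_smul_left,
      mul_pow, dist_eq_norm, Real.norm_of_nonneg (sq_nonneg _)]
  have h2 : ‖x‖ ^ 2 = dist x q ^ 2 + 2 * inner ℝ (x - q) q + ‖q‖ ^ 2 := by
    rw [dist_eq_norm, ← norm_add_sq_real, sub_add_cancel]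
  rw [h1, h2, hq]
  field_simp
  ring

open EuclideanGeometry in
theorem HyperbolicDerivBound.comp_inversion {E G : Type*} [NormedAddCommGroup E]
    [InnerProductSpace ℝ E] [NormedAddCommGroup G] [NormedSpace ℝ G] {g : E → G} {M R : ℝ} {q : E}
    (hg : HyperbolicDerivBound g M) (hR : R ≠ 0) (hq : ‖q‖ ^ 2 = R ^ 2 + 1) :
    HyperbolicDerivBound (g ∘ inversion q R) M := by
  intro x hx
  have hxq : x ≠ q := by
    rintro rfl
    nlinarith [norm_nonneg x, sq_nonneg R]
  have hd : 0 < dist x q := dist_pos.2 hxq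
  have hi := one_sub_norm_sq_inversion hq hxq
  have hp := one_sub_norm_sq_pos hx
  have hι : ‖inversion q R x‖ < 1 := by
    have : 0 < (R / dist x q) ^ 2 * (1 - ‖x‖ ^ 2) := by positivity
    nlinarith [norm_nonneg (inversion q R x)]
  obtain ⟨A, hA, hAb⟩ := hg _ hι
  obtain ⟨T, hT, hTn⟩ := exists_hasFDerivAt_inversion R hxq
  refine ⟨A.comp T, hA.comp x hT, fun v => ?_⟩
  have h := hAb (T v)
  rw [hi, hTn] at h
  have hk : 0 < (R / dist x q) ^ 2 := by positivity
  refine le_of_mul_le_mul_left ?_ hk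
  calc _ = ‖A (T v)‖ * ((R / dist x q) ^ 2 * (1 - ‖x‖ ^ 2)) := by
        rw [ContinuousLinearMap.comp_apply]; ring
    _ ≤ _ := h
    _ = _ := by ring

open EuclideanGeometry in
theorem HyperbolicDerivBound.norm_sub_le {E G : Type*} [NormedAddCommGroup E]
    [InnerProductSpace ℝ E] [NormedAddCommGroup G] [NormedSpace ℝ G] {g : E → G} {M : ℝ}
    (hM : 0 ≤ M) (hg : HyperbolicDerivBound g M) {p y : E} (hp : ‖p‖ < 1) (hy : ‖y‖ < 1) :
    ‖g y - g p‖ ≤ M * ‖y - p‖ / (√(1 - ‖p‖ ^ 2) * √(1 - ‖y‖ ^ 2)) := by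
  rcases eq_or_ne p 0 with rfl | hp0
  · simpa using hg.norm_sub_zero_le hM hy
  have hn : 0 < ‖p‖ := norm_pos_iff.2 hp0
  have hpp := one_sub_norm_sq_pos hp
  have hyp := one_sub_norm_sq_pos hy
  obtain ⟨R, hR, hR2⟩ : ∃ R : ℝ, 0 < R ∧ R ^ 2 = (1 - ‖p‖ ^ 2) / ‖p‖ ^ 2 :=
    ⟨√((1 - ‖p‖ ^ 2) / ‖p‖ ^ 2), by positivity, Real.sq_sqrt (by positivity)⟩
  obtain ⟨q, hqdef⟩ : ∃ q : E, q = (‖p‖ ^ 2)⁻¹ • p := ⟨_, rfl⟩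
  have hqn : ‖q‖ = ‖p‖⁻¹ := by
    rw [hqdef, norm_smul, norm_inv, norm_pow, norm_norm]
    field_simp
  have hq : ‖q‖ ^ 2 = R ^ 2 + 1 := by
    rw [hqn, hR2]
    field_simp
    ring
  have hne : ∀ {x : E}, ‖x‖ < 1 → x ≠ q := by
    rintro x hx rfl
    nlinarith [norm_nonneg x, sq_nonneg R]
  have h0 : inversion q R 0 = p := by
    have hk : (R / dist 0 q) ^ 2 = 1 - ‖p‖ ^ 2 := by
      rw [dist_zero_left, hqn, div_pow, hR2]
      field_simp
    rw [inversion, hk, hqdef, vsub_eq_sub, vadd_eq_add, zero_sub, smul_neg, smul_smul, ← neg_smul,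
      ← add_smul]
    convert one_smul ℝ p
    field_simp
    ring
  obtain ⟨v, rfl⟩ := inversion_surjective q hR.ne' y
  have hvq : v ≠ q := by
    rintro rfl
    exact hne hy (inversion_self _ _)
  have hdv : 0 < dist v q := dist_pos.2 hvq
  have h0q : (0 : E) ≠ q := hne (by simp)
  have hd0 : 0 < dist 0 q := dist_pos.2 h0q
  have hiv := one_sub_norm_sq_inversion hq hvq
  have hi0 := one_sub_norm_sq_inversion hq h0q
  have hvp : 0 < 1 - ‖v‖ ^ 2 := by
    rw [hiv] at hyp
    exact pos_of_mul_pos_right hyp (sq_nonneg _)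
  have hv : ‖v‖ < 1 := by nlinarith [norm_nonneg v]
  have key := (hg.comp_inversion hR.ne' hq).norm_sub_zero_le hM hv
  rw [Function.comp_apply, Function.comp_apply, h0] at key
  refine key.trans_eq ?_
  rw [← dist_eq_norm _ p, ← h0, dist_inversion_inversion hvq h0q, hiv, hi0,
    Real.sqrt_mul (sq_nonneg _), Real.sqrt_mul (sq_nonneg _), Real.sqrt_sq (by positivity),
    Real.sqrt_sq (by positivity), dist_zero_right v]
  have := Real.sqrt_pos.2 hvp
  simp only [norm_zero, ne_eq, OfNat.ofNat_ne_zero, not_false_eq_true, zero_pow, sub_zero,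
    Real.sqrt_one, mul_one]
  field_simp

theorem dist_toLp_pole {F : Type*} [NormedAddCommGroup F] (w : F) :
    dist (WithLp.toLp 2 (w, (0 : ℝ))) (WithLp.toLp 2 ((0 : F), (1 : ℝ))) = √(1 + ‖w‖ ^ 2) := by
  simp [WithLp.prod_dist_eq_of_L2, add_comm]

theorem toLp_ne_pole {F : Type*} [NormedAddCommGroup F] (w : F) :
    WithLp.toLp 2 (w, (0 : ℝ)) ≠ WithLp.toLp 2 ((0 : F), (1 : ℝ)) := by
  simp

open EuclideanGeometry in
/-- Inverse stereographic projection, as an inversion of `F × ℝ` restricted to `F × {0}`. -/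
noncomputable def stereoInv {F : Type*} [NormedAddCommGroup F] [InnerProductSpace ℝ F] (w : F) :
    WithLp 2 (F × ℝ) :=
  inversion (WithLp.toLp 2 ((0 : F), (1 : ℝ))) 1 (WithLp.toLp 2 (w, (0 : ℝ)))

theorem norm_stereoInv_sub {F : Type*} [NormedAddCommGroup F] [InnerProductSpace ℝ F]
    (w z : F) :
    ‖stereoInv w - stereoInv z‖ = ‖w - z‖ / (√(1 + ‖w‖ ^ 2) * √(1 + ‖z‖ ^ 2)) := by
  rw [← dist_eq_norm, stereoInv, stereoInv,
    EuclideanGeometry.dist_inversion_inversion (toLp_ne_pole w) (toLp_ne_pole z),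
    dist_toLp_pole, dist_toLp_pole, WithLp.prod_dist_eq_of_L2]
  simp [dist_eq_norm, div_eq_inv_mul]

theorem exists_hasFDerivAt_stereoInv {F : Type*} [NormedAddCommGroup F] [InnerProductSpace ℝ F]
    (w : F) :
    ∃ A : F →L[ℝ] WithLp 2 (F × ℝ), HasFDerivAt stereoInv A w ∧
      ∀ v, ‖A v‖ = ‖v‖ / (1 + ‖w‖ ^ 2) := by
  obtain ⟨T, hT, hTn⟩ := exists_hasFDerivAt_inversion 1 (toLp_ne_pole w)
  let J : F →L[ℝ] WithLp 2 (F × ℝ) :=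
    (WithLp.prodContinuousLinearEquiv 2 ℝ F ℝ).symm.toContinuousLinearMap.comp
      (ContinuousLinearMap.inl ℝ F ℝ)
  refine ⟨T.comp J, HasFDerivAt.comp (f := J) w hT J.hasFDerivAt, fun v => ?_⟩
  have hJ : ‖J v‖ = ‖v‖ := by
    have : J v = WithLp.toLp 2 (v, (0 : ℝ)) := rfl
    rw [this]
    simp
  rw [ContinuousLinearMap.comp_apply, hTn, hJ, dist_toLp_pole, div_pow,
    Real.sq_sqrt (by positivity)]
  ring


theorem stmt7 (m : ℕ)
    (f : EuclideanSpace ℝ (Fin m) → EuclideanSpace ℝ (Fin 2))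
    (f' : EuclideanSpace ℝ (Fin m) → EuclideanSpace ℝ (Fin m) →L[ℝ] EuclideanSpace ℝ (Fin 2))
    (hf : ∀ x, ‖x‖ < 1 → HasFDerivAt f (f' x) x)
    (M : ℝ) (hM : 0 ≤ M) :
    (∀ x, ‖x‖ < 1 → ‖f' x‖ / (1 + ‖f x‖ ^ 2) ≤ M / (1 - ‖x‖ ^ 2)) ↔
      ∀ x y, ‖x‖ < 1 → ‖y‖ < 1 →
        ‖f x - f y‖ ≤ M * ‖x - y‖ *
          (Real.sqrt (1 + ‖f x‖ ^ 2) * Real.sqrt (1 + ‖f y‖ ^ 2)) /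
            (Real.sqrt (1 - ‖x‖ ^ 2) * Real.sqrt (1 - ‖y‖ ^ 2)) := by
  constructor
  · intro h x y hx hy
    have hg : HyperbolicDerivBound (stereoInv ∘ f) M := by
      intro z hz
      obtain ⟨A, hA, hAn⟩ := exists_hasFDerivAt_stereoInv (f z)
      refine ⟨A.comp (f' z), hA.comp z (hf z hz), fun v => ?_⟩
      have hp := one_sub_norm_sq_pos hz
      rw [ContinuousLinearMap.comp_apply, hAn]
      calc ‖f' z v‖ / (1 + ‖f z‖ ^ 2) * (1 - ‖z‖ ^ 2)
          ≤ ‖f' z‖ * ‖v‖ / (1 + ‖f z‖ ^ 2) * (1 - ‖z‖ ^ 2) := by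
            gcongr
            exact (f' z).le_opNorm v
        _ = ‖f' z‖ / (1 + ‖f z‖ ^ 2) * (1 - ‖z‖ ^ 2) * ‖v‖ := by ring
        _ ≤ M / (1 - ‖z‖ ^ 2) * (1 - ‖z‖ ^ 2) * ‖v‖ := by
            gcongr ?_ * _ * _
            exact h z hz
        _ = M * ‖v‖ := by rw [div_mul_cancel₀ _ hp.ne']
    have key := hg.norm_sub_le hM hy hx
    rw [Function.comp_apply, Function.comp_apply, norm_stereoInv_sub,
      div_le_iff₀ (by positivity)] at key
    exact key.trans_eq (by ring)
  · intro h x hx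
    have hp := one_sub_norm_sq_pos hx
    have hsq := Real.sqrt_pos.2 hp
    rw [div_le_iff₀ (by positivity)]
    let K : EuclideanSpace ℝ (Fin m) → ℝ := fun y =>
      M * (√(1 + ‖f y‖ ^ 2) * √(1 + ‖f x‖ ^ 2)) / (√(1 - ‖y‖ ^ 2) * √(1 - ‖x‖ ^ 2))
    have hK : ContinuousAt K x := by
      have := (hf x hx).continuousAt
      have hne : √(1 - ‖x‖ ^ 2) * √(1 - ‖x‖ ^ 2) ≠ 0 := by positivity
      fun_prop (disch := assumption)
    have hKx : K x = M / (1 - ‖x‖ ^ 2) * (1 + ‖f x‖ ^ 2) := by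
      simp only [K]
      rw [Real.mul_self_sqrt (by positivity), Real.mul_self_sqrt hp.le]
      ring
    rw [← hKx]
    refine le_of_forall_gt fun C hC => ?_
    obtain ⟨C', hC', hCC⟩ := exists_between hC
    have hK0 : 0 ≤ K x := by positivity
    refine lt_of_le_of_lt ((hf x hx).le_of_lip' (hK0.trans hC'.le) ?_) hCC
    have hball : ∀ᶠ y in nhds x, ‖y‖ < 1 := continuous_norm.continuousAt.eventually_lt_const hx
    filter_upwards [hball, hK.eventually_lt_const hC'] with y hy hKy
    calc ‖f y - f x‖ ≤ _ := h y x hy hx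
      _ = K y * ‖y - x‖ := by simp only [K]; ring
      _ ≤ C' * ‖y - x‖ := by gcongr
end

section
/- Let B = {x ∈ ℝ^m : ‖x‖ < 1} be the open unit ball of Euclidean space ℝ^m, let f : B → ℝ² be Fréchet differentiable at every point of B, and let M ≥ 0 be a constant such that ‖Df(x)‖ / (1 + ‖f(x)‖²) ≤ M / (1 − ‖x‖²) for every x ∈ B. Then ‖f(x) − f(y)‖ ≤ M ‖x − y‖ · (√(1 + ‖f(x)‖²) · √(1 + ‖f(y)‖²)) / (√(1 − ‖x‖²) · √(1 − ‖y‖²)) for all x, y ∈ B. -/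
/-- The point `(w, 1)` of the `L²` product `E × ℝ`. Its inversion in the unit sphere is the inverse
stereographic projection of `w` onto a sphere of radius `1 / 2`. -/
noncomputable def liftOne {E : Type*} (w : E) : WithLp 2 (E × ℝ) := WithLp.toLp 2 (w, 1)

section Chordal

open Set EuclideanGeometry

variable {E : Type*} [NormedAddCommGroup E]

lemma norm_sq_liftOne (w : E) : ‖liftOne w‖ ^ 2 = 1 + ‖w‖ ^ 2 := by
  simp [WithLp.prod_norm_sq_eq_of_L2, liftOne, add_comm]

lemma norm_liftOne (w : E) : ‖liftOne w‖ = Real.sqrt (1 + ‖w‖ ^ 2) := by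
  rw [← norm_sq_liftOne, Real.sqrt_sq (norm_nonneg _)]

lemma liftOne_ne_zero (w : E) : liftOne w ≠ 0 := by
  rw [← norm_ne_zero_iff, norm_liftOne]
  positivity

lemma dist_liftOne (w z : E) : dist (liftOne w) (liftOne z) = ‖w - z‖ := by
  rw [dist_eq_norm, liftOne, liftOne, ← WithLp.toLp_sub]
  simp

variable [InnerProductSpace ℝ E]

lemma hasDerivAt_liftOne_comp {g : ℝ → E} {g' : E} {t : ℝ} (hg : HasDerivAt g g' t) :
    HasDerivAt (fun s => liftOne (g s)) (WithLp.toLp 2 (g', (0 : ℝ))) t :=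
  (WithLp.prodContinuousLinearEquiv 2 ℝ E ℝ).symm.hasFDerivAt.comp_hasDerivAt t
    (hg.prodMk (hasDerivAt_const t (1 : ℝ)))

/-- The map `s ↦ inversion 0 1 (liftOne (g s))` has speed `‖g'‖ / (1 + ‖g‖ ^ 2)`. -/
lemma exists_hasDerivAt_inversion_liftOne_comp {g : ℝ → E} {g' : E} {t : ℝ} (hg : HasDerivAt g g' t) :
    ∃ v, HasDerivAt (fun s => inversion 0 1 (liftOne (g s))) v t ∧
      ‖v‖ = ‖g'‖ / (1 + ‖g t‖ ^ 2) := by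
  refine ⟨_, HasFDerivAt.comp_hasDerivAt (l := inversion (0 : WithLp 2 (E × ℝ)) 1) t
    (hasFDerivAt_inversion (liftOne_ne_zero (g t))) (hasDerivAt_liftOne_comp hg), ?_⟩
  have h : (0 : ℝ) ≤ 1 + ‖g t‖ ^ 2 := by positivity
  simp [norm_smul, norm_sq_liftOne, abs_of_nonneg h]
  ring

/-- Mean value inequality for the chordal metric. -/
lemma chordal_le_of_norm_deriv_le {g g' : ℝ → E} {B B' : ℝ → ℝ}
    (hg : ∀ t ∈ Icc (0 : ℝ) 1, HasDerivAt g (g' t) t)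
    (hB : ∀ t ∈ Icc (0 : ℝ) 1, HasDerivAt B (B' t) t) (hB0 : B 0 = 0)
    (bound : ∀ t ∈ Icc (0 : ℝ) 1, ‖g' t‖ / (1 + ‖g t‖ ^ 2) ≤ B' t) :
    ‖g 1 - g 0‖ ≤ B 1 * (Real.sqrt (1 + ‖g 1‖ ^ 2) * Real.sqrt (1 + ‖g 0‖ ^ 2)) := by
  choose! v hv hvn using fun t ht => exists_hasDerivAt_inversion_liftOne_comp (hg t ht)
  have key := image_norm_le_of_norm_deriv_right_le_deriv_boundary'
    (f := fun s => inversion 0 1 (liftOne (g s)) - inversion 0 1 (liftOne (g 0))) (B := B)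
    (fun t ht => ((hv t ht).sub_const _).continuousAt.continuousWithinAt)
    (fun t ht => ((hv t (Ico_subset_Icc_self ht)).sub_const _).hasDerivWithinAt)
    (by simp [hB0]) (fun t ht => (hB t ht).continuousAt.continuousWithinAt)
    (fun t ht => (hB t (Ico_subset_Icc_self ht)).hasDerivWithinAt)
    (fun t ht => (hvn t (Ico_subset_Icc_self ht)).trans_le (bound t (Ico_subset_Icc_self ht)))
    (right_mem_Icc.2 zero_le_one)
  rw [← dist_eq_norm, dist_inversion_inversion (liftOne_ne_zero _) (liftOne_ne_zero _),
    dist_liftOne, dist_zero_right, dist_zero_right, norm_liftOne, norm_liftOne, one_pow,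
    one_div_mul_eq_div, div_le_iff₀ (by positivity)] at key
  exact key

end Chordal

/-- The map `t ↦ t / √(a * ((1 - t) * a + t * b))` grows at least as fast as a primitive of
`1 / ((1 - t) * a + t * b)`; the comparison is the inequality between the arithmetic and the
geometric mean. -/
lemma exists_hasDerivAt_ge_one_div_segment {a b t : ℝ} (ha : 0 < a)
    (hl : 0 < (1 - t) * a + t * b) :
    ∃ d, HasDerivAt (fun s => s / (Real.sqrt a * Real.sqrt ((1 - s) * a + s * b))) d t ∧
      1 / ((1 - t) * a + t * b) ≤ d := by
  have hlin : HasDerivAt (fun s : ℝ => (1 - s) * a + s * b) (b - a) t := by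
    have := (((hasDerivAt_id t).const_sub 1).mul_const a).add ((hasDerivAt_id t).mul_const b)
    exact this.congr_deriv (by ring)
  set l := (1 - t) * a + t * b with hl_def
  have hsa := Real.sqrt_pos.2 ha
  have hsl := Real.sqrt_pos.2 hl
  refine ⟨_, (hasDerivAt_id t).div ((hlin.sqrt hl.ne').const_mul (Real.sqrt a)) (by positivity), ?_⟩
  simp only [id, ← hl_def]
  have h1 := Real.sq_sqrt ha.le
  have h2 := Real.sq_sqrt hl.le
  set p := Real.sqrt a
  set q := Real.sqrt l
  have htl : t * (b - a) = q ^ 2 - p ^ 2 := by rw [h1, h2, hl_def]; ring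
  have hd : (1 * (p * q) - t * (p * ((b - a) / (2 * q)))) / (p * q) ^ 2
      = (p ^ 2 + q ^ 2) / (2 * p * q ^ 3) := by
    have : t * (p * ((b - a) / (2 * q))) = p * (q ^ 2 - p ^ 2) / (2 * q) := by
      rw [← htl]; ring
    rw [this]
    field_simp
    ring
  rw [hd, ← h2, div_le_div_iff₀ (by positivity) (by positivity)]
  nlinarith [mul_nonneg (sq_nonneg q) (sq_nonneg (p - q))]

open AffineMap in
lemma one_sub_norm_sq_lineMap_ge {V : Type*} [NormedAddCommGroup V] [InnerProductSpace ℝ V]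
    (x y : V) {t : ℝ} (ht : t ∈ Set.Icc (0 : ℝ) 1) :
    (1 - t) * (1 - ‖x‖ ^ 2) + t * (1 - ‖y‖ ^ 2) ≤ 1 - ‖lineMap (k := ℝ) x y t‖ ^ 2 := by
  have h : ‖lineMap (k := ℝ) x y t‖ ^ 2 =
      (1 - t) * ‖x‖ ^ 2 + t * ‖y‖ ^ 2 - t * (1 - t) * ‖x - y‖ ^ 2 := by
    rw [lineMap_apply_module, norm_add_sq_real, norm_sub_sq_real, norm_smul, norm_smul,
      real_inner_smul_left, real_inner_smul_right, mul_pow, mul_pow, Real.norm_eq_abs,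
      Real.norm_eq_abs, sq_abs, sq_abs]
    ring
  have := mul_nonneg (mul_nonneg ht.1 (sub_nonneg.2 ht.2)) (sq_nonneg ‖x - y‖)
  linarith

theorem stmt8 (m : ℕ)
    (f : EuclideanSpace ℝ (Fin m) → EuclideanSpace ℝ (Fin 2))
    (f' : EuclideanSpace ℝ (Fin m) → EuclideanSpace ℝ (Fin m) →L[ℝ] EuclideanSpace ℝ (Fin 2))
    (hf : ∀ x, ‖x‖ < 1 → HasFDerivAt f (f' x) x)
    (M : ℝ) (hM : 0 ≤ M)
    (hbd : ∀ x, ‖x‖ < 1 → ‖f' x‖ / (1 + ‖f x‖ ^ 2) ≤ M / (1 - ‖x‖ ^ 2)) :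
    ∀ x y, ‖x‖ < 1 → ‖y‖ < 1 →
      ‖f x - f y‖ ≤ M * ‖x - y‖ *
        (Real.sqrt (1 + ‖f x‖ ^ 2) * Real.sqrt (1 + ‖f y‖ ^ 2)) /
          (Real.sqrt (1 - ‖x‖ ^ 2) * Real.sqrt (1 - ‖y‖ ^ 2)) := by
  intro x y hx hy
  have ha : 0 < 1 - ‖x‖ ^ 2 := by nlinarith [norm_nonneg x]
  have hb : 0 < 1 - ‖y‖ ^ 2 := by nlinarith [norm_nonneg y]
  have hl : ∀ t ∈ Set.Icc (0 : ℝ) 1, 0 < (1 - t) * (1 - ‖x‖ ^ 2) + t * (1 - ‖y‖ ^ 2) :=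
    fun t ht => (convex_Ioi (0 : ℝ)) ha hb (sub_nonneg.2 ht.2) ht.1 (by ring)
  have hball : ∀ t ∈ Set.Icc (0 : ℝ) 1, ‖AffineMap.lineMap (k := ℝ) x y t‖ < 1 := fun t ht => by
    have := (hl t ht).trans_le (one_sub_norm_sq_lineMap_ge x y ht)
    nlinarith [norm_nonneg (AffineMap.lineMap (k := ℝ) x y t)]
  choose! d hd hdl using fun t ht => exists_hasDerivAt_ge_one_div_segment (t := t) ha (hl t ht)
  have key := chordal_le_of_norm_deriv_le
    (g := fun t => f (AffineMap.lineMap x y t))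
    (fun t ht => (hf _ (hball t ht)).comp_hasDerivAt t AffineMap.hasDerivAt_lineMap)
    (fun t ht => (hd t ht).const_mul (M * ‖x - y‖)) (by simp) (fun t ht => by
      have hq := one_sub_norm_sq_lineMap_ge x y ht
      set p := AffineMap.lineMap (k := ℝ) x y t
      calc ‖f' p (y - x)‖ / (1 + ‖f p‖ ^ 2)
          ≤ ‖f' p‖ * ‖y - x‖ / (1 + ‖f p‖ ^ 2) := by
            gcongr
            exact (f' p).le_opNorm _
        _ = ‖f' p‖ / (1 + ‖f p‖ ^ 2) * ‖x - y‖ := by rw [norm_sub_rev y x]; ring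
        _ ≤ M / (1 - ‖p‖ ^ 2) * ‖x - y‖ := by
            exact mul_le_mul_of_nonneg_right (hbd p (hball t ht)) (norm_nonneg _)
        _ = M * ‖x - y‖ * (1 / (1 - ‖p‖ ^ 2)) := by ring
        _ ≤ M * ‖x - y‖ * d t := by
            gcongr
            exact (one_div_le_one_div_of_le (hl t ht) hq).trans (hdl t ht))
  simp only [AffineMap.lineMap_apply_one, AffineMap.lineMap_apply_zero, sub_self, zero_mul,
    one_mul, zero_add] at key
  rw [norm_sub_rev]
  refine key.trans_eq ?_
  ring
end

section
/- Let X and Y be real normed vector spaces, let Ω ⊆ X be an open convex set, let g : [0, ∞) → (0, ∞) be continuous and nondecreasing, and let f : Ω → Y be Fréchet differentiable at every point of Ω. Then sup_{x ∈ Ω} ‖Df(x)‖ / g(‖x‖) = sup_{x, y ∈ Ω, x ≠ y} (1 / max{g(‖x‖), g(‖y‖)}) · ‖f(x) − f(y)‖ / ‖x − y‖, where both suprema are taken in [0, ∞]. -/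
/-- On an open convex set, the pointwise bound `‖f' x‖ ≤ C * g ‖x‖` on the derivative is equivalent
to the weighted Lipschitz bound with weight `max (g ‖x‖) (g ‖y‖)`. -/
theorem forall_norm_fderiv_le_mul_iff {X Y : Type*} [NormedAddCommGroup X] [NormedSpace ℝ X]
    [NormedAddCommGroup Y] [NormedSpace ℝ Y]
    {Ω : Set X} (hΩo : IsOpen Ω) (hΩc : Convex ℝ Ω)
    {g : ℝ → ℝ} (hgc : ContinuousOn g (Set.Ici 0)) (hgm : MonotoneOn g (Set.Ici 0))
    (hgp : ∀ t ∈ Set.Ici (0 : ℝ), 0 < g t)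
    {f : X → Y} {f' : X → X →L[ℝ] Y} (hf : ∀ x ∈ Ω, HasFDerivAt f (f' x) x)
    {C : ℝ} (hC : 0 ≤ C) :
    (∀ x ∈ Ω, ‖f' x‖ ≤ C * g ‖x‖) ↔
      ∀ x ∈ Ω, ∀ y ∈ Ω, x ≠ y → ‖f x - f y‖ ≤ C * max (g ‖x‖) (g ‖y‖) * ‖x - y‖ := by
  constructor
  · intro h x hx y hy _
    have hsub : segment ℝ x y ⊆ Ω := hΩc.segment_subset hx hy
    refine (convex_segment x y).norm_image_sub_le_of_norm_hasFDerivWithin_le (f' := f')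
      (fun z hz => (hf z (hsub hz)).hasFDerivWithinAt) (fun z hz => ?_)
      (right_mem_segment ℝ x y) (left_mem_segment ℝ x y)
    refine (h z (hsub hz)).trans (mul_le_mul_of_nonneg_left ?_ hC)
    have hz' : ‖z‖ ≤ max ‖x‖ ‖y‖ :=
      (convexOn_norm convex_univ).le_max_of_mem_segment (Set.mem_univ x) (Set.mem_univ y) hz
    rcases le_max_iff.1 hz' with hzx | hzy
    · exact le_max_of_le_left (hgm (norm_nonneg z) (norm_nonneg x) hzx)
    · exact le_max_of_le_right (hgm (norm_nonneg z) (norm_nonneg y) hzy)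
  · intro h x hx
    refine le_of_forall_gt_imp_ge_of_dense fun K hK => ?_
    have hcont : Continuous fun y : X => C * max (g ‖y‖) (g ‖x‖) :=
      continuous_const.mul
        ((hgc.comp_continuous continuous_norm fun y => norm_nonneg y).max continuous_const)
    have hgx : ∀ᶠ y in nhds x, C * max (g ‖y‖) (g ‖x‖) < K :=
      hcont.continuousAt.eventually_lt_const (by simpa using hK)
    have hK0 : 0 ≤ K := (mul_nonneg hC (hgp _ (norm_nonneg x)).le).trans hK.le
    refine (hf x hx).le_of_lip' hK0 ?_
    filter_upwards [hgx, hΩo.mem_nhds hx] with y hy hyΩ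
    rcases eq_or_ne y x with rfl | hyx
    · simp
    · exact (h y hyΩ x hx hyx).trans (mul_le_mul_of_nonneg_right hy.le (norm_nonneg _))

theorem stmt13 {X Y : Type*} [NormedAddCommGroup X] [NormedSpace ℝ X]
    [NormedAddCommGroup Y] [NormedSpace ℝ Y]
    (Ω : Set X) (hΩo : IsOpen Ω) (hΩc : Convex ℝ Ω)
    (g : ℝ → ℝ) (hgc : ContinuousOn g (Set.Ici 0)) (hgm : MonotoneOn g (Set.Ici 0))
    (hgp : ∀ t ∈ Set.Ici (0 : ℝ), 0 < g t)
    (f : X → Y) (f' : X → X →L[ℝ] Y) (hf : ∀ x ∈ Ω, HasFDerivAt f (f' x) x) :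
    (⨆ (x : X) (_ : x ∈ Ω), ENNReal.ofReal (‖f' x‖ / g ‖x‖)) =
      ⨆ (x : X) (_ : x ∈ Ω) (y : X) (_ : y ∈ Ω) (_ : x ≠ y),
        ENNReal.ofReal (1 / max (g ‖x‖) (g ‖y‖) * (‖f x - f y‖ / ‖x - y‖)) := by
  refine eq_of_forall_ge_iff fun c => ?_
  induction c with
  | top => simp
  | coe C =>
    have hpos (x : X) : 0 < g ‖x‖ := hgp _ (norm_nonneg x)
    simp only [iSup_le_iff, ENNReal.ofReal_le_coe]
    refine Iff.trans (forall₂_congr fun x _ => div_le_iff₀ (hpos x))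
      ((forall_norm_fderiv_le_mul_iff hΩo hΩc hgc hgm hgp hf C.coe_nonneg).trans
        (forall₂_congr fun x _ => forall₃_congr fun y _ hxy => ?_))
    have hm : 0 < max (g ‖x‖) (g ‖y‖) := lt_max_of_lt_left (hpos x)
    have hn : 0 < ‖x - y‖ := norm_pos_iff.2 (sub_ne_zero.2 hxy)
    rw [div_mul_div_comm, one_mul, div_le_iff₀ (mul_pos hm hn), mul_assoc]
end

section
/- Let X and Y be real normed vector spaces, let B_X = {x ∈ X : ‖x‖ < 1} be the open unit ball of X, and let f : B_X → Y be Fréchet differentiable at every point of B_X. Let φ : (−1, 1) → ℝ be differentiable with derivative φ′ continuous, positive and nondecreasing on [0, 1), and satisfying φ(b) − φ(a) ≤ √(φ′(a)) · √(φ′(b)) · (b − a) for all 0 ≤ a < b < 1 (properties enjoyed by every operator monotone function on (−1, 1)). Then sup_{x ∈ B_X} ‖Df(x)‖ / φ′(‖x‖) = sup_{x, y ∈ B_X, x ≠ y} ‖f(x) − f(y)‖ / (√(φ′(‖x‖)) · √(φ′(‖y‖)) · ‖x − y‖), where both suprema are taken in [0, ∞]. -/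
open Filter Topology

/-- A derivative bound by `M * φ' ‖x‖` integrates along segments of the unit ball. -/
lemma norm_sub_le_of_norm_fderiv_le_deriv_norm {X Y : Type*}
    [NormedAddCommGroup X] [NormedSpace ℝ X] [NormedAddCommGroup Y] [NormedSpace ℝ Y]
    {f : X → Y} {f' : X → X →L[ℝ] Y} (hf : ∀ x : X, ‖x‖ < 1 → HasFDerivAt f (f' x) x)
    {φ φ' : ℝ → ℝ} (hφ : ∀ t ∈ Set.Ioo (-1 : ℝ) 1, HasDerivAt φ (φ' t) t)
    (hφ'p : ∀ t ∈ Set.Ico (0 : ℝ) 1, 0 < φ' t) (hφ'm : MonotoneOn φ' (Set.Ico 0 1))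
    (hineq : ∀ a b : ℝ, 0 ≤ a → a < b → b < 1 →
      φ b - φ a ≤ Real.sqrt (φ' a) * Real.sqrt (φ' b) * (b - a))
    {M : ℝ} (hM : 0 ≤ M) (hfM : ∀ x : X, ‖x‖ < 1 → ‖f' x‖ ≤ M * φ' ‖x‖)
    {x y : X} (hx : ‖x‖ < 1) (hy : ‖y‖ < 1) :
    ‖f x - f y‖ ≤ M * (Real.sqrt (φ' ‖x‖) * Real.sqrt (φ' ‖y‖) * ‖x - y‖) := by
  wlog hxy : ‖x‖ ≤ ‖y‖ generalizing x y
  · have := this hy hx (le_of_not_ge hxy)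
    rwa [norm_sub_rev, norm_sub_rev y x, mul_comm (Real.sqrt (φ' ‖y‖))] at this
  have hseg : ∀ t ∈ Set.Icc (0 : ℝ) 1,
      ‖x + t • (y - x)‖ ≤ ‖x‖ + t * (‖y‖ - ‖x‖) := by
    rintro t ⟨h0, h1⟩
    have : x + t • (y - x) = (1 - t) • x + t • y := by module
    calc ‖x + t • (y - x)‖ ≤ ‖(1 - t) • x‖ + ‖t • y‖ := this ▸ norm_add_le _ _
      _ = ‖x‖ + t * (‖y‖ - ‖x‖) := by
        rw [norm_smul, norm_smul, Real.norm_of_nonneg h0, Real.norm_of_nonneg (by linarith)]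
        ring
  have hlt : ∀ t ∈ Set.Icc (0 : ℝ) 1, ‖x‖ + t * (‖y‖ - ‖x‖) < 1 := by
    rintro t ⟨h0, h1⟩
    nlinarith
  have hderiv : ∀ t ∈ Set.Icc (0 : ℝ) 1, HasDerivAt (fun s : ℝ => f (x + s • (y - x)) - f x)
      (f' (x + t • (y - x)) (y - x)) t := by
    intro t ht
    have hline : HasDerivAt (fun s : ℝ => x + s • (y - x)) (y - x) t := by
      simpa using ((hasDerivAt_id t).smul_const (y - x)).const_add x
    exact ((hf _ ((hseg t ht).trans_lt (hlt t ht))).comp_hasDerivAt t hline).sub_const _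
  have hbound : ∀ t ∈ Set.Icc (0 : ℝ) 1, ‖f' (x + t • (y - x)) (y - x)‖ ≤
      M * φ' (‖x‖ + t * (‖y‖ - ‖x‖)) * ‖x - y‖ := by
    intro t ht
    have hlt' := (hseg t ht).trans_lt (hlt t ht)
    rw [norm_sub_rev x y]
    refine (ContinuousLinearMap.le_opNorm _ _).trans ?_
    gcongr
    refine (hfM _ hlt').trans ?_
    gcongr
    exact hφ'm ⟨norm_nonneg _, hlt'⟩ ⟨(norm_nonneg _).trans (hseg t ht), hlt t ht⟩ (hseg t ht)
  have hcont : ContinuousOn (fun s : ℝ => f (x + s • (y - x)) - f x) (Set.Icc 0 1) :=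
    fun t ht => (hderiv t ht).continuousAt.continuousWithinAt
  have hright : ∀ t ∈ Set.Ico (0 : ℝ) 1, HasDerivWithinAt
      (fun s : ℝ => f (x + s • (y - x)) - f x) (f' (x + t • (y - x)) (y - x)) (Set.Ici t) t :=
    fun t ht => (hderiv t (Set.Ico_subset_Icc_self ht)).hasDerivWithinAt
  have hone : (1 : ℝ) ∈ Set.Icc (0 : ℝ) 1 := ⟨zero_le_one, le_rfl⟩
  rw [norm_sub_rev (f x)]
  rcases hxy.eq_or_lt with heq | hlt'
  · have key := norm_image_sub_le_of_norm_deriv_right_le_segment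
      (C := M * φ' ‖x‖ * ‖x - y‖) hcont hright
      (fun t ht => by simpa [← heq] using hbound t (Set.Ico_subset_Icc_self ht)) 1 hone
    have hpos := (hφ'p _ ⟨norm_nonneg x, hx⟩).le
    rw [← heq, Real.mul_self_sqrt hpos]
    simpa [mul_assoc] using key
  · have hd : 0 < ‖y‖ - ‖x‖ := sub_pos.2 hlt'
    have hB : ∀ t ∈ Set.Icc (0 : ℝ) 1, HasDerivAt
        (fun s => M * ‖x - y‖ * ((φ (‖x‖ + s * (‖y‖ - ‖x‖)) - φ ‖x‖) / (‖y‖ - ‖x‖)))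
        (M * φ' (‖x‖ + t * (‖y‖ - ‖x‖)) * ‖x - y‖) t := by
      intro t ht
      have hline : HasDerivAt (fun s : ℝ => ‖x‖ + s * (‖y‖ - ‖x‖)) (‖y‖ - ‖x‖) t := by
        simpa using ((hasDerivAt_id t).mul_const (‖y‖ - ‖x‖)).const_add ‖x‖
      have hmem : ‖x‖ + t * (‖y‖ - ‖x‖) ∈ Set.Ioo (-1 : ℝ) 1 :=
        ⟨by linarith [(norm_nonneg _).trans (hseg t ht)], hlt t ht⟩
      refine (((((hφ _ hmem).comp t hline).sub_const (φ ‖x‖)).div_const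
        (‖y‖ - ‖x‖)).const_mul (M * ‖x - y‖)).congr_deriv ?_
      rw [mul_div_cancel_right₀ _ hd.ne']
      ring
    have key := image_norm_le_of_norm_deriv_right_le_deriv_boundary' hcont hright
      (by simp) (fun t ht => (hB t ht).continuousAt.continuousWithinAt)
      (fun t ht => (hB t (Set.Ico_subset_Icc_self ht)).hasDerivWithinAt)
      (fun t ht => hbound t (Set.Ico_subset_Icc_self ht)) hone
    have hratio : (φ ‖y‖ - φ ‖x‖) / (‖y‖ - ‖x‖) ≤ Real.sqrt (φ' ‖x‖) * Real.sqrt (φ' ‖y‖) :=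
      (div_le_iff₀ hd).2 (hineq _ _ (norm_nonneg _) hlt' hy)
    calc ‖f y - f x‖ ≤ M * ‖x - y‖ * ((φ ‖y‖ - φ ‖x‖) / (‖y‖ - ‖x‖)) := by simpa using key
      _ ≤ M * ‖x - y‖ * (Real.sqrt (φ' ‖x‖) * Real.sqrt (φ' ‖y‖)) := by gcongr
      _ = _ := by ring

/-- A weighted Lipschitz bound on the unit ball bounds the derivative pointwise. -/
lemma norm_fderiv_le_of_norm_sub_le_sqrt_mul_sqrt {X Y : Type*}
    [NormedAddCommGroup X] [NormedSpace ℝ X] [NormedAddCommGroup Y] [NormedSpace ℝ Y]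
    {f : X → Y} {w : ℝ → ℝ} (hwc : ContinuousOn w (Set.Ico 0 1))
    {K : ℝ} (hK : 0 ≤ K) {x : X} (hx : ‖x‖ < 1) (hwx : 0 ≤ w ‖x‖)
    {L : X →L[ℝ] Y} (hf : HasFDerivAt f L x)
    (hfK : ∀ y : X, ‖y‖ < 1 →
      ‖f y - f x‖ ≤ K * (Real.sqrt (w ‖y‖) * Real.sqrt (w ‖x‖) * ‖y - x‖)) :
    ‖L‖ ≤ K * w ‖x‖ := by
  have hball : ∀ᶠ y in 𝓝 x, ‖y‖ < 1 := continuous_norm.continuousAt.eventually_lt_const hx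
  have htend : Tendsto (fun y : X => Real.sqrt (w ‖y‖)) (𝓝 x) (𝓝 (Real.sqrt (w ‖x‖))) := by
    refine ((hwc ‖x‖ ⟨norm_nonneg x, hx⟩).tendsto.comp
      (tendsto_nhdsWithin_iff.2 ⟨continuous_norm.continuousAt, ?_⟩)).sqrt
    exact hball.mono fun y hy => ⟨norm_nonneg y, hy⟩
  have hle : ∀ s, Real.sqrt (w ‖x‖) < s → ‖L‖ ≤ K * (s * Real.sqrt (w ‖x‖)) := by
    intro s hs
    have hs0 : 0 ≤ s := (Real.sqrt_nonneg _).trans hs.le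
    refine hf.le_of_lip' (by positivity) ?_
    filter_upwards [hball, htend.eventually_lt_const hs] with y hy hys
    calc _ ≤ K * (Real.sqrt (w ‖y‖) * Real.sqrt (w ‖x‖) * ‖y - x‖) := hfK y hy
      _ ≤ K * (s * Real.sqrt (w ‖x‖) * ‖y - x‖) := by gcongr
      _ = _ := by ring
  have hlim : Tendsto (fun s => K * (s * Real.sqrt (w ‖x‖))) (𝓝[>] Real.sqrt (w ‖x‖))
      (𝓝 (K * (Real.sqrt (w ‖x‖) * Real.sqrt (w ‖x‖)))) :=
    (Continuous.tendsto (by fun_prop) _).mono_left nhdsWithin_le_nhds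
  rw [Real.mul_self_sqrt hwx] at hlim
  exact ge_of_tendsto hlim (eventually_mem_nhdsWithin.mono hle)


theorem stmt17 {X Y : Type*} [NormedAddCommGroup X] [NormedSpace ℝ X]
    [NormedAddCommGroup Y] [NormedSpace ℝ Y]
    (f : X → Y) (f' : X → X →L[ℝ] Y)
    (hf : ∀ x : X, ‖x‖ < 1 → HasFDerivAt f (f' x) x)
    (φ φ' : ℝ → ℝ)
    (hφ : ∀ t ∈ Set.Ioo (-1 : ℝ) 1, HasDerivAt φ (φ' t) t)
    (hφ'c : ContinuousOn φ' (Set.Ico 0 1))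
    (hφ'p : ∀ t ∈ Set.Ico (0 : ℝ) 1, 0 < φ' t)
    (hφ'm : MonotoneOn φ' (Set.Ico 0 1))
    (hineq : ∀ a b : ℝ, 0 ≤ a → a < b → b < 1 →
      φ b - φ a ≤ Real.sqrt (φ' a) * Real.sqrt (φ' b) * (b - a)) :
    (⨆ (x : X) (_ : ‖x‖ < 1), ENNReal.ofReal (‖f' x‖ / φ' ‖x‖)) =
      ⨆ (x : X) (_ : ‖x‖ < 1) (y : X) (_ : ‖y‖ < 1) (_ : x ≠ y),
        ENNReal.ofReal (‖f x - f y‖ /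
          (Real.sqrt (φ' ‖x‖) * Real.sqrt (φ' ‖y‖) * ‖x - y‖)) := by
  apply le_antisymm
  · set S := ⨆ (x : X) (_ : ‖x‖ < 1) (y : X) (_ : ‖y‖ < 1) (_ : x ≠ y),
        ENNReal.ofReal (‖f x - f y‖ /
          (Real.sqrt (φ' ‖x‖) * Real.sqrt (φ' ‖y‖) * ‖x - y‖)) with hS
    rcases eq_or_ne S ⊤ with htop | htop
    · simp [htop]
    refine iSup₂_le fun x hx => ?_
    have hpx := hφ'p _ ⟨norm_nonneg x, hx⟩
    rw [ENNReal.ofReal_le_iff_le_toReal htop, div_le_iff₀ hpx]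
    refine norm_fderiv_le_of_norm_sub_le_sqrt_mul_sqrt hφ'c ENNReal.toReal_nonneg hx hpx.le
      (hf x hx) fun y hy => ?_
    rcases eq_or_ne y x with rfl | hyx
    · simp
    have hpy := hφ'p _ ⟨norm_nonneg y, hy⟩
    have hsub : 0 < ‖y - x‖ := norm_pos_iff.2 (sub_ne_zero.2 hyx)
    rw [← div_le_iff₀ (by positivity), ← ENNReal.ofReal_le_iff_le_toReal htop, hS]
    exact le_iSup₂_of_le y hy (le_iSup₂_of_le x hx (le_iSup_of_le hyx le_rfl))
  · set S := ⨆ (x : X) (_ : ‖x‖ < 1), ENNReal.ofReal (‖f' x‖ / φ' ‖x‖) with hS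
    rcases eq_or_ne S ⊤ with htop | htop
    · simp [htop]
    refine iSup₂_le fun x hx => iSup₂_le fun y hy => iSup_le fun hxy => ?_
    have hpx := hφ'p _ ⟨norm_nonneg x, hx⟩
    have hpy := hφ'p _ ⟨norm_nonneg y, hy⟩
    have hsub : 0 < ‖x - y‖ := norm_pos_iff.2 (sub_ne_zero.2 hxy)
    rw [ENNReal.ofReal_le_iff_le_toReal htop, div_le_iff₀ (by positivity)]
    refine norm_sub_le_of_norm_fderiv_le_deriv_norm hf hφ hφ'p hφ'm hineq
      ENNReal.toReal_nonneg (fun z hz => ?_) hx hy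
    rw [← div_le_iff₀ (hφ'p _ ⟨norm_nonneg z, hz⟩), ← ENNReal.ofReal_le_iff_le_toReal htop, hS]
    exact le_iSup₂_of_le z hz le_rfl
end
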